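/- arXiv:1008.3475 — 2 statements merged into one kernel-verified Lean document; each statement's English description precedes it below -/
import Mathlib

section
/- For all integers n ≥ 0, the number of overpartitions of 3n satisfies p̄(3n) ≡ (-1)^n · r₅(n) (mod 3). -/
/-- Number of overpartitions of `n`: pairs consisting of a partition of some
`m ≤ n` into distinct parts (the overlined parts) and a partition of `n - m`. -/
def pbar (n : ℕ) : ℕ :=
  ∑ m ∈ Finset.range (n + 1),
    (Nat.Partition.distincts m).card * Fintype.card (Nat.Partition (n - m))

/-- `r₅(n)`: number of representations of `n` as a sum of five squares. -/
noncomputable def r5 (n : ℕ) : ℕ :=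
  Nat.card {x : ℤ × ℤ × ℤ × ℤ × ℤ //
    x.1 ^ 2 + x.2.1 ^ 2 + x.2.2.1 ^ 2 + x.2.2.2.1 ^ 2 + x.2.2.2.2 ^ 2 = (n : ℤ)}

open PowerSeries

/-- The telescoping step behind the finite form of Gauss's identity. -/
theorem shanks_telescope {R : Type*} [CommRing R] (q : R) {m n : ℕ} (h : m ≤ n) :
    -2 * q ^ (n + 1) * ∏ j ∈ Finset.range n, (1 - q ^ (j + 1)) +
      ∑ t ∈ Finset.range m, 2 * (-1) ^ (t + 1) *
        (q ^ ((t + 1) * (n + 2)) * (1 - q ^ (n + 1)) -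
          (1 + q ^ (n + 1)) * q ^ ((t + 1) * (n + 1))) *
        (∏ j ∈ Finset.Ico (t + 1) n, (1 - q ^ (j + 1))) *
        ∏ j ∈ Finset.range t, (1 + q ^ (j + 1)) =
    2 * (-1) ^ (m + 1) * q ^ ((m + 1) * (n + 1)) *
      (∏ j ∈ Finset.Ico m n, (1 - q ^ (j + 1))) * ∏ j ∈ Finset.range m, (1 + q ^ (j + 1)) := by
  induction m with
  | zero => simp
  | succ m ih =>
    rw [Finset.sum_range_succ, ← add_assoc, ih (by lia),
      Finset.prod_eq_prod_Ico_succ_bot (show m < n by lia), Finset.prod_range_succ]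
    ring

/-- Shanks' finite form of Gauss's identity `∑ (-1)^k q^(k^2) = ∏ (1 - q^j) / (1 + q^j)`. -/
theorem shanks_gauss {R : Type*} [CommRing R] (q : R) (n : ℕ) :
    (1 + ∑ k ∈ Finset.range n, 2 * (-1) ^ (k + 1) * q ^ (k + 1) ^ 2) *
      ∏ j ∈ Finset.range n, (1 + q ^ (j + 1)) =
    ∏ j ∈ Finset.range n, (1 - q ^ (j + 1)) +
      ∑ t ∈ Finset.range n, 2 * (-1) ^ (t + 1) * q ^ ((t + 1) * (n + 1)) *
        (∏ j ∈ Finset.Ico (t + 1) n, (1 - q ^ (j + 1))) *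
        ∏ j ∈ Finset.range t, (1 + q ^ (j + 1)) := by
  induction n with
  | zero => simp
  | succ n ih =>
    have key := shanks_telescope q (le_refl n)
    have split : ∑ t ∈ Finset.range n, 2 * (-1) ^ (t + 1) * q ^ ((t + 1) * (n + 1 + 1)) *
          (∏ j ∈ Finset.Ico (t + 1) (n + 1), (1 - q ^ (j + 1))) *
          ∏ j ∈ Finset.range t, (1 + q ^ (j + 1)) =
        ∑ t ∈ Finset.range n, 2 * (-1) ^ (t + 1) *
          (q ^ ((t + 1) * (n + 2)) * (1 - q ^ (n + 1)) -
            (1 + q ^ (n + 1)) * q ^ ((t + 1) * (n + 1))) *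
          (∏ j ∈ Finset.Ico (t + 1) n, (1 - q ^ (j + 1))) *
          ∏ j ∈ Finset.range t, (1 + q ^ (j + 1)) +
        (1 + q ^ (n + 1)) * ∑ t ∈ Finset.range n, 2 * (-1) ^ (t + 1) * q ^ ((t + 1) * (n + 1)) *
          (∏ j ∈ Finset.Ico (t + 1) n, (1 - q ^ (j + 1))) *
          ∏ j ∈ Finset.range t, (1 + q ^ (j + 1)) := by
      rw [Finset.mul_sum, ← Finset.sum_add_distrib]
      refine Finset.sum_congr rfl fun t ht => ?_
      rw [Finset.prod_Ico_succ_top (by simpa using ht)]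
      ring
    rw [Finset.sum_range_succ _ n, Finset.sum_range_succ _ n, Finset.prod_range_succ,
      Finset.prod_range_succ, split]
    simp only [Finset.Ico_self, Finset.prod_empty, mul_one] at key ⊢
    linear_combination (1 + q ^ (n + 1)) * ih - key

open Filter PowerSeries.WithPiTopology in
/-- Gauss's identity, with `θ` any series agreeing with the partial sums of
`∑ k : ℤ, (-1) ^ k * X ^ k ^ 2`. -/
theorem theta_mul_distincts {R : Type*} [CommRing R] (θ : R⟦X⟧)
    (hθ : ∀ n N, n ≤ N → θ.coeff n = (1 + ∑ k ∈ Finset.range N,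
      2 * (-1) ^ (k + 1) * (X : R⟦X⟧) ^ (k + 1) ^ 2).coeff n) :
    θ * PowerSeries.mk (fun n => ((Nat.Partition.distincts n).card : R)) =
      pentagonalSeries R := by
  let _ : TopologicalSpace R := ⊥
  have _ : DiscreteTopology R := ⟨rfl⟩
  have hD : Tendsto (fun N => ∏ j ∈ Finset.range N, (1 + (X : R⟦X⟧) ^ (j + 1))) atTop
      (nhds (PowerSeries.mk fun n => ((Nat.Partition.distincts n).card : R))) := by
    have := (Nat.Partition.hasProd_powerSeriesMk_card_countRestricted R Nat.two_pos).tendsto_prod_nat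
    simpa only [Finset.sum_range_succ, Finset.sum_range_zero, zero_add, mul_zero, pow_zero, mul_one,
      Nat.Partition.countRestricted_two] using this
  have hE := (hasProd_one_sub_X_pow R).tendsto_prod_nat
  have hT : Tendsto (fun N => 1 + ∑ k ∈ Finset.range N,
      2 * (-1) ^ (k + 1) * (X : R⟦X⟧) ^ (k + 1) ^ 2) atTop (nhds θ) := by
    rw [tendsto_iff_coeff_tendsto]
    exact fun d => tendsto_atTop_of_eventually_const fun N hN => (hθ d N hN).symm
  refine tendsto_nhds_unique (hT.mul hD) ?_
  simp_rw [shanks_gauss]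
  rw [← add_zero (pentagonalSeries R)]
  refine hE.add ?_
  rw [tendsto_iff_coeff_tendsto]
  refine fun d => tendsto_atTop_of_eventually_const (i₀ := d) fun N hN => ?_
  rw [map_zero, map_sum]
  refine Finset.sum_eq_zero fun t _ => ?_
  rw [mul_right_comm _ (X ^ _), mul_right_comm _ (X ^ _), coeff_mul_X_pow', if_neg]
  nlinarith

open PowerSeries.WithPiTopology in
/-- Euler's product for the partition function. -/
theorem partitions_mul_pentagonalSeries {R : Type*} [CommRing R] :
    PowerSeries.mk (fun n => (Fintype.card (Nat.Partition n) : R)) * pentagonalSeries R = 1 := by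
  let _ : TopologicalSpace R := ⊥
  have _ : DiscreteTopology R := ⟨rfl⟩
  have h := (Nat.Partition.hasProd_powerSeriesMk_card_restricted R fun _ => True).mul
    (hasProd_one_sub_X_pow R)
  simp only [if_true, pow_mul] at h
  simp_rw [tsum_pow_mul_one_sub_of_constantCoeff_eq_zero (R := R)
    (f := X ^ (_ + 1)) (by simp)] at h
  simpa [Nat.Partition.restricted] using h.unique hasProd_one

theorem pbar_mul_theta {R : Type*} [CommRing R] (θ : R⟦X⟧)
    (hθ : ∀ n N, n ≤ N → θ.coeff n = (1 + ∑ k ∈ Finset.range N,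
      2 * (-1) ^ (k + 1) * (X : R⟦X⟧) ^ (k + 1) ^ 2).coeff n) :
    PowerSeries.mk (fun n => (pbar n : R)) * θ = 1 := by
  have h : PowerSeries.mk (fun n => (pbar n : R)) =
      PowerSeries.mk (fun n => ((Nat.Partition.distincts n).card : R)) *
        PowerSeries.mk (fun n => (Fintype.card (Nat.Partition n) : R)) := by
    ext n
    simp [coeff_mul, pbar, Finset.Nat.sum_antidiagonal_eq_sum_range_succ_mk]
  rw [h, mul_comm, ← mul_assoc, theta_mul_distincts θ hθ, mul_comm,
    partitions_mul_pentagonalSeries]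

/-- The generating function counting the elements of `α` by weight. -/
noncomputable def weightSeries (R : Type*) [CommRing R] {α : Type*} (w : α → ℕ) : R⟦X⟧ :=
  PowerSeries.mk fun n => (Nat.card {a // w a = n} : R)

/-- Pairs of total weight `n`, sorted by the weights of their components. -/
def pairsOfWeightEquiv {α β : Type*} (w : α → ℕ) (v : β → ℕ) (n : ℕ) :
    {x : α × β // w x.1 + v x.2 = n} ≃
      Σ p : Finset.HasAntidiagonal.antidiagonal n, {a // w a = p.1.1} × {b // v b = p.1.2} where
  toFun x := ⟨⟨(w x.1.1, v x.1.2), by simpa using x.2⟩, ⟨x.1.1, rfl⟩, ⟨x.1.2, rfl⟩⟩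
  invFun y := ⟨(y.2.1.1, y.2.2.1), by
    rw [y.2.1.2, y.2.2.2]; exact Finset.HasAntidiagonal.mem_antidiagonal.1 y.1.2⟩
  left_inv _ := rfl
  right_inv := by
    rintro ⟨⟨⟨i, j⟩, h⟩, ⟨a, ha⟩, ⟨b, hb⟩⟩
    dsimp only at ha hb
    subst ha hb
    rfl

theorem finite_pairsOfWeight {α β : Type*} {w : α → ℕ} {v : β → ℕ}
    (hw : ∀ n, Finite {a // w a = n}) (hv : ∀ n, Finite {b // v b = n}) (n : ℕ) :
    Finite {x : α × β // w x.1 + v x.2 = n} :=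
  Finite.of_equiv _ (pairsOfWeightEquiv w v n).symm

theorem weightSeries_prod {R : Type*} [CommRing R] {α β : Type*} {w : α → ℕ} {v : β → ℕ}
    (hw : ∀ n, Finite {a // w a = n}) (hv : ∀ n, Finite {b // v b = n}) :
    weightSeries R (fun x : α × β => w x.1 + v x.2) = weightSeries R w * weightSeries R v := by
  ext n
  simp only [weightSeries, coeff_mk, coeff_mul]
  rw [Nat.card_congr (pairsOfWeightEquiv w v n), Nat.card_sigma]
  simp only [Nat.card_prod, Nat.cast_sum, Nat.cast_mul]
  exact Finset.sum_coe_sort (Finset.HasAntidiagonal.antidiagonal n) fun p : ℕ × ℕ =>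
    (Nat.card {a // w a = p.1} : R) * (Nat.card {b // v b = p.2} : R)

/-- The weight `x ^ 2` on the integers, as a natural number. -/
def sqWeight (x : ℤ) : ℕ := x.natAbs ^ 2

theorem coe_sqWeight (x : ℤ) : (sqWeight x : ℤ) = x ^ 2 := by simp [sqWeight]

theorem sqWeight_eq_iff_mem {n N : ℕ} (h : n ≤ N) (x : ℤ) :
    sqWeight x = n ↔ x ∈ {x ∈ Finset.Icc (-N : ℤ) N | sqWeight x = n} := by
  simp only [Finset.mem_filter, Finset.mem_Icc, iff_and_self]
  intro hx
  have : x.natAbs ≤ n := hx ▸ Nat.le_self_pow two_ne_zero _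
  lia

theorem finite_sqWeight (n : ℕ) : Finite {x // sqWeight x = n} := by
  exact (Set.Finite.subset (Finset.finite_toSet _) fun x hx =>
    (sqWeight_eq_iff_mem le_rfl x).1 hx).to_subtype

/-- The theta series `∑ x : ℤ, X ^ x ^ 2`. -/
noncomputable def thetaSeries (R : Type*) [CommRing R] : R⟦X⟧ := weightSeries R sqWeight

theorem one_add_sum_eq_sum_Icc {R : Type*} [CommRing R] (q : R) (N : ℕ) :
    1 + ∑ k ∈ Finset.range N, 2 * (-1) ^ (k + 1) * q ^ (k + 1) ^ 2 =
      ∑ x ∈ Finset.Icc (-N : ℤ) N, (-q) ^ sqWeight x := by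
  rw [Finset.sum_Icc_of_even_eq_range (fun x => by simp [sqWeight]), Finset.sum_range_succ']
  have h : ∀ k : ℕ, (-q) ^ sqWeight (k + 1 : ℕ) = (-1) ^ (k + 1) * q ^ (k + 1) ^ 2 := fun k => by
    rw [sqWeight, Int.natAbs_natCast, neg_pow]
    congr 1
    rcases Nat.even_or_odd (k + 1) with hk | hk
    · rw [hk.neg_one_pow, (hk.pow_of_ne_zero two_ne_zero).neg_one_pow]
    · rw [hk.neg_one_pow, hk.pow.neg_one_pow]
  simp only [h, two_nsmul, mul_assoc, ← Finset.mul_sum]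
  simp [sqWeight]
  ring

theorem coeff_rescale_thetaSeries {R : Type*} [CommRing R] {n N : ℕ} (h : n ≤ N) :
    (rescale (-1) (thetaSeries R)).coeff n = (1 + ∑ k ∈ Finset.range N,
      2 * (-1) ^ (k + 1) * (X : R⟦X⟧) ^ (k + 1) ^ 2).coeff n := by
  rw [one_add_sum_eq_sum_Icc, coeff_rescale, thetaSeries, weightSeries, coeff_mk]
  rw [Nat.card_congr (Equiv.subtypeEquivRight (sqWeight_eq_iff_mem h)), Nat.card_eq_fintype_card,
    Fintype.card_coe, Finset.card_filter, map_sum, Nat.cast_sum, Finset.mul_sum]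
  refine Finset.sum_congr rfl fun x _ => ?_
  rw [neg_pow X, ← map_one C, ← map_neg, ← map_pow, coeff_C_mul_X_pow]
  split_ifs <;> grind

theorem thetaSeries_sq (R : Type*) [CommRing R] :
    thetaSeries R ^ 2 = weightSeries R (fun x : ℤ × ℤ => sqWeight x.1 + sqWeight x.2) := by
  rw [weightSeries_prod finite_sqWeight finite_sqWeight, thetaSeries, sq]

theorem coeff_thetaSeries_pow_five (R : Type*) [CommRing R] (n : ℕ) :
    (thetaSeries R ^ 5).coeff n = r5 n := by
  have h2 := finite_pairsOfWeight finite_sqWeight finite_sqWeight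
  have h3 := finite_pairsOfWeight finite_sqWeight h2
  have h4 := finite_pairsOfWeight finite_sqWeight h3
  have h : thetaSeries R ^ 5 = weightSeries R (fun x : ℤ × ℤ × ℤ × ℤ × ℤ => sqWeight x.1 +
      (sqWeight x.2.1 + (sqWeight x.2.2.1 + (sqWeight x.2.2.2.1 + sqWeight x.2.2.2.2)))) := by
    rw [weightSeries_prod finite_sqWeight h4, weightSeries_prod finite_sqWeight h3,
      weightSeries_prod finite_sqWeight h2, weightSeries_prod finite_sqWeight finite_sqWeight,
      thetaSeries]
    ring
  rw [h, weightSeries, coeff_mk, r5]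
  congr 1
  refine Nat.card_congr (Equiv.subtypeEquivRight fun x => ?_)
  rw [← Nat.cast_inj (R := ℤ)]
  push_cast [coe_sqWeight]
  simp only [add_assoc]

theorem three_dvd_of_sq_add_sq {x y : ℤ} (h : 3 ∣ x ^ 2 + y ^ 2) : 3 ∣ x ∧ 3 ∣ y := by
  have hx : x % 3 = 0 ∨ x % 3 = 1 ∨ x % 3 = 2 := by lia
  have hy : y % 3 = 0 ∨ y % 3 = 1 ∨ y % 3 = 2 := by lia
  rw [Int.dvd_iff_emod_eq_zero] at h
  rcases hx with hx | hx | hx <;> rcases hy with hy | hy | hy <;>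
    simp [Int.dvd_iff_emod_eq_zero, Int.add_emod, pow_two, Int.mul_emod, hx, hy] at h ⊢

theorem coeff_three_mul_thetaSeries_sq (R : Type*) [CommRing R] (n : ℕ) :
    (thetaSeries R ^ 2).coeff (3 * n) =
      ((thetaSeries R ^ 2).expand 3 three_ne_zero).coeff n := by
  rw [coeff_expand, thetaSeries_sq, weightSeries, coeff_mk]
  split_ifs with h
  · obtain ⟨m, rfl⟩ := h
    rw [Nat.mul_div_cancel_left _ three_pos, coeff_mk]
    congr 1
    refine (Nat.card_congr (Equiv.ofBijective
      (fun x : {x : ℤ × ℤ // sqWeight x.1 + sqWeight x.2 = m} =>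
        (⟨(3 * x.1.1, 3 * x.1.2), ?_⟩ :
          {x : ℤ × ℤ // sqWeight x.1 + sqWeight x.2 = 3 * (3 * m)})) ⟨?_, ?_⟩)).symm
    · have := x.2
      simp only [sqWeight, Int.natAbs_mul] at *
      grind
    · rintro ⟨⟨a, b⟩, _⟩ ⟨⟨c, d⟩, _⟩ h
      simpa using h
    · rintro ⟨⟨a, b⟩, hab⟩
      zify [coe_sqWeight] at hab
      obtain ⟨⟨c, rfl⟩, ⟨d, rfl⟩⟩ := three_dvd_of_sq_add_sq ⟨_, hab⟩
      refine ⟨⟨(c, d), ?_⟩, rfl⟩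
      zify [coe_sqWeight]
      linarith
  · rw [Nat.card_eq_zero.2 (.inl ⟨?_⟩), Nat.cast_zero]
    rintro ⟨⟨a, b⟩, hab⟩
    zify [coe_sqWeight] at hab
    obtain ⟨⟨c, rfl⟩, ⟨d, rfl⟩⟩ := three_dvd_of_sq_add_sq ⟨_, hab⟩
    refine h ?_
    zify
    exact ⟨c ^ 2 + d ^ 2, by linarith⟩

theorem coeff_three_mul_mul_expand {R : Type*} [CommRing R] (f g : R⟦X⟧) (n : ℕ) :
    (f * g.expand 3 three_ne_zero).coeff (3 * n) =
      ((PowerSeries.mk fun m => f.coeff (3 * m)) * g).coeff n := by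
  rw [coeff_mul, coeff_mul]
  symm
  refine Finset.sum_of_injOn (fun p => (3 * p.1, 3 * p.2)) ?_ ?_ ?_ ?_
  · rintro ⟨a, b⟩ _ ⟨c, d⟩ _ h
    simpa using h
  · rintro ⟨a, b⟩ h
    simp at h ⊢
    lia
  · rintro ⟨a, b⟩ h h'
    rw [coeff_expand_of_not_dvd, mul_zero]
    rintro ⟨d, rfl⟩
    refine h' ⟨(n - d, d), ?_⟩
    simp at h ⊢
    lia
  · rintro ⟨a, b⟩ _
    simp

theorem pow_three_eq_expand (f : (ZMod 3)⟦X⟧) : f ^ 3 = f.expand 3 three_ne_zero := by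
  have h := MvPowerSeries.map_frobenius_expand (R := ZMod 3) 3 three_ne_zero (f := f)
  rw [← h, ZMod.frobenius_zmod, MvPowerSeries.map_id]
  rfl

theorem pbar_three_mul_congr (n : ℕ) :
    (pbar (3 * n) : ℤ) ≡ (-1) ^ n * r5 n [ZMOD 3] := by
  set φ := thetaSeries (ZMod 3)
  set P : (ZMod 3)⟦X⟧ := rescale (-1) (PowerSeries.mk fun m => (pbar m : ZMod 3)) with hP
  have hPφ : P * φ = 1 := by
    have h := congrArg (rescale (-1 : ZMod 3))
      (pbar_mul_theta _ fun _ _ => coeff_rescale_thetaSeries (R := ZMod 3))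
    simpa [map_mul, rescale_rescale] using h
  set U : (ZMod 3)⟦X⟧ := PowerSeries.mk fun m => P.coeff (3 * m) with hU
  have hUφ : U * φ = φ ^ 6 := by
    have h3 : P * φ.expand 3 three_ne_zero = φ ^ 2 := by
      rw [← pow_three_eq_expand]
      linear_combination φ ^ 2 * hPφ
    ext m
    rw [← coeff_three_mul_mul_expand, h3, coeff_three_mul_thetaSeries_sq, ← pow_three_eq_expand,
      ← pow_mul]
  have hU5 : U = φ ^ 5 := by linear_combination P * hUφ + (φ ^ 5 - U) * hPφ
  have hn := congrArg (coeff n) hU5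
  rw [coeff_thetaSeries_pow_five, hU, coeff_mk, hP, coeff_rescale, coeff_mk, pow_mul] at hn
  refine (ZMod.intCast_eq_intCast_iff _ _ 3).1 ?_
  push_cast
  rw [← hn, ← mul_assoc, ← mul_pow]
  norm_num
end

section
/- For all integers n ≥ 0, the number of partitions of 3n+2 without repeated odd parts satisfies pod(3n+2) ≡ (-1)^n · r₅(8n+5) (mod 3). -/
/-- `pod n`: number of partitions of `n` in which odd parts are not repeated. -/
noncomputable def pod (n : ℕ) : ℕ :=
  Nat.card {p : n.Partition // ∀ i, Odd i → p.parts.count i ≤ 1}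

open Finset PowerSeries
open scoped PowerSeries.WithPiTopology

/-- The `n`-th triangular number. -/
def triangular (n : ℕ) : ℕ := n * (n + 1) / 2

theorem two_mul_triangular (n : ℕ) : 2 * triangular n = n * (n + 1) :=
  Nat.mul_div_cancel' (Nat.even_mul_succ_self n).two_dvd

theorem le_triangular (n : ℕ) : n ≤ triangular n := by
  have h := two_mul_triangular n
  rcases n with _ | n
  · simp
  · nlinarith

/-- The generating function of the fibre sizes of `w : α → ℕ`. -/
noncomputable def fiberSeries (R : Type*) [CommSemiring R] {α : Type*} (w : α → ℕ) : R⟦X⟧ :=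
  PowerSeries.mk fun n ↦ (Nat.card {a // w a = n} : R)

section FiberSeries

variable {R : Type*} [CommSemiring R] {α β : Type*} {w : α → ℕ} {v : β → ℕ}

theorem coeff_fiberSeries (w : α → ℕ) (n : ℕ) :
    coeff n (fiberSeries R w) = Nat.card {a // w a = n} :=
  coeff_mk _ _

/-- A fibre of a sum of two functions decomposes along the antidiagonal. -/
def fiberAddEquiv (w : α → ℕ) (v : β → ℕ) (n : ℕ) :
    {p : α × β // w p.1 + v p.2 = n} ≃
      Σ ij : antidiagonal n, {a // w a = ij.1.1} × {b // v b = ij.1.2} where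
  toFun p := ⟨⟨(w p.1.1, v p.1.2), mem_antidiagonal.2 p.2⟩, ⟨p.1.1, rfl⟩, ⟨p.1.2, rfl⟩⟩
  invFun s := ⟨(s.2.1, s.2.2), by rw [s.2.1.2, s.2.2.2]; exact mem_antidiagonal.1 s.1.2⟩
  left_inv _ := rfl
  right_inv := by
    rintro ⟨⟨⟨i, j⟩, _⟩, (x : {a // w a = i} × {b // v b = j})⟩
    obtain ⟨⟨a, rfl⟩, ⟨b, rfl⟩⟩ := x
    rfl

theorem finite_fiber_add (hw : ∀ n, Finite {a // w a = n}) (hv : ∀ n, Finite {b // v b = n})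
    (n : ℕ) : Finite {p : α × β // w p.1 + v p.2 = n} :=
  Finite.of_equiv _ (fiberAddEquiv w v n).symm

theorem fiberSeries_mul (hw : ∀ n, Finite {a // w a = n}) (hv : ∀ n, Finite {b // v b = n}) :
    fiberSeries R w * fiberSeries R v = fiberSeries R fun p : α × β ↦ w p.1 + v p.2 := by
  ext n
  rw [coeff_mul, coeff_fiberSeries, Nat.card_congr (fiberAddEquiv w v n), Nat.card_sigma,
    univ_eq_attach,
    sum_attach _ (fun ij : ℕ × ℕ ↦ Nat.card ({a // w a = ij.1} × {b // v b = ij.2}))]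
  simp [coeff_fiberSeries, Nat.card_prod]

end FiberSeries

/-- Ramanujan's theta function `ψ(q) = ∑ q ^ (n (n + 1) / 2)`. -/
noncomputable abbrev psi (R : Type*) [CommSemiring R] : R⟦X⟧ := fiberSeries R triangular

theorem finite_triangular_fiber (n : ℕ) : Finite {s // triangular s = n} :=
  ((Set.finite_Iic n).subset fun s (hs : triangular s = n) ↦ by
    simpa [← hs] using le_triangular s).to_subtype

theorem coeff_sum_X_pow_triangular {R : Type*} [CommSemiring R] {n m : ℕ} (h : n < m) :
    coeff n (∑ s ∈ range m, (X : R⟦X⟧) ^ triangular s) = coeff n (psi R) := by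
  have hcard : Nat.card {s // triangular s = n} = #{s ∈ range m | n = triangular s} := by
    refine Nat.subtype_card _ fun s ↦ ?_
    have := le_triangular s
    simp only [mem_filter, mem_range]
    omega
  rw [coeff_fiberSeries, hcard, map_sum, card_filter]
  simp [coeff_X_pow]

/-- A finite form, due to Shanks, of Gauss's product formula for `psi`. -/
theorem sum_pow_triangular_eq {A : Type*} [CommRing A] [IsDomain A] (q : A) (P a : ℕ → A)
    (hPa : ∀ n, P n * a n = 1) (hq : ∀ n, 1 - q ^ (2 * n + 1) ≠ 0)
    (hP : ∀ n, P (n + 1) * (1 - q ^ (2 * n + 1)) = P n * (1 - q ^ (2 * n + 2)))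
    (ha : ∀ n, a (n + 1) * (1 - q ^ (2 * n + 2)) = a n * (1 - q ^ (2 * n + 1))) (n : ℕ) :
    ∑ s ∈ range (2 * n), q ^ triangular s =
      P n * ∑ s ∈ range n, a s * q ^ (s * (2 * n + 1)) := by
  have htele (n m : ℕ) : (1 - q ^ (2 * n + 2)) * ∑ s ∈ range m, a s * q ^ (s * (2 * n + 3)) -
      (1 - q ^ (2 * n + 1)) * ∑ s ∈ range m, a s * q ^ (s * (2 * n + 1)) =
      a m * (1 - q ^ (2 * m)) * q ^ (m * (2 * n + 1)) := by
    induction m with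
    | zero => simp
    | succ m ih =>
      rw [sum_range_succ, sum_range_succ]
      linear_combination ih - q ^ ((m + 1) * (2 * n + 1)) * ha m
  induction n with
  | zero => simp
  | succ n ih =>
    have h₁ : triangular (2 * n) = n * (2 * n + 1) := by
      have := two_mul_triangular (2 * n); nlinarith
    have h₂ : triangular (2 * n + 1) = (n + 1) * (2 * n + 1) := by
      have := two_mul_triangular (2 * n + 1); nlinarith
    have ht := htele n (n + 1)
    rw [sum_range_succ (fun s ↦ a s * q ^ (s * (2 * n + 1)))] at ht
    apply mul_right_cancel₀ (hq n)
    rw [show 2 * (n + 1) = 2 * n + 1 + 1 by ring, sum_range_succ, sum_range_succ, ih, h₁, h₂]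
    set S := ∑ s ∈ range n, a s * q ^ (s * (2 * n + 1))
    set S' := ∑ s ∈ range (n + 1), a s * q ^ (s * (2 * n + 3))
    linear_combination (-P n) * ht - S' * hP n
      - q ^ ((n + 1) * (2 * n + 1)) * P n * ha n
      - (1 - q ^ (2 * n + 1)) * (q ^ (n * (2 * n + 1)) + q ^ ((n + 1) * (2 * n + 1))) * hPa n

section ProductFormula

variable (K : Type*) [Field K]

/-- Partial products of `∏ (1 - q ^ (2 k)) / (1 - q ^ (2 k - 1))`. -/
noncomputable def gaussProd (n : ℕ) : K⟦X⟧ :=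
  ∏ k ∈ range n, (1 - X ^ (2 * k + 2)) * (1 - X ^ (2 * k + 1))⁻¹

variable {K}

theorem one_sub_X_pow_succ_mul_inv (n : ℕ) :
    (1 - X ^ (n + 1) : K⟦X⟧) * (1 - X ^ (n + 1))⁻¹ = 1 :=
  PowerSeries.mul_inv_cancel _ (by simp)

theorem gaussProd_succ_mul (n : ℕ) :
    gaussProd K (n + 1) * (1 - X ^ (2 * n + 1)) = gaussProd K n * (1 - X ^ (2 * n + 2)) := by
  rw [gaussProd, prod_range_succ, ← gaussProd]
  linear_combination gaussProd K n * (1 - X ^ (2 * n + 2)) * one_sub_X_pow_succ_mul_inv (K := K) (2 * n)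

theorem coeff_gaussProd {n m : ℕ} (h : n < 2 * m) :
    coeff n (gaussProd K m) = coeff n (psi K) := by
  let a (n : ℕ) : K⟦X⟧ :=
    ∏ k ∈ range n, (1 - X ^ (2 * k + 1)) * (1 - X ^ (2 * k + 2))⁻¹
  have key := sum_pow_triangular_eq (X : K⟦X⟧) (gaussProd K) a
    (fun n ↦ by
      rw [gaussProd, ← prod_mul_distrib]
      refine prod_eq_one fun k _ ↦ ?_
      linear_combination (1 - X ^ (2 * k + 2) : K⟦X⟧) * (1 - X ^ (2 * k + 2))⁻¹ *
        one_sub_X_pow_succ_mul_inv (K := K) (2 * k) + one_sub_X_pow_succ_mul_inv (K := K) (2 * k + 1))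
    (fun n ↦ left_ne_zero_of_mul_eq_one (one_sub_X_pow_succ_mul_inv (2 * n)))
    gaussProd_succ_mul
    (fun n ↦ by
      simp only [a, prod_range_succ]
      linear_combination a n * (1 - X ^ (2 * n + 1)) * one_sub_X_pow_succ_mul_inv (K := K) (2 * n + 1)) m
  obtain ⟨m, rfl⟩ : ∃ k, m = k + 1 := ⟨m - 1, by omega⟩
  rw [← coeff_sum_X_pow_triangular h, key, sum_range_succ', mul_add, map_add]
  have hdvd : (X : K⟦X⟧) ^ (n + 1) ∣ gaussProd K (m + 1) *
      ∑ s ∈ range m, a (s + 1) * X ^ ((s + 1) * (2 * (m + 1) + 1)) :=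
    (dvd_sum fun s _ ↦ (pow_dvd_pow X (by nlinarith)).mul_left _).mul_left _
  rw [X_pow_dvd_iff.1 hdvd n n.lt_succ_self]
  simp [a]

open Filter Topology

/-- The signed weights `(-1) ^ n` of the partitions of `n` without repeated odd parts. -/
def podWeight (K : Type*) [Field K] (i c : ℕ) : K :=
  if Odd i → c ≤ 1 then (-1) ^ (i * c) else 0

theorem genFun_podWeight :
    Nat.Partition.genFun (podWeight K) = PowerSeries.mk fun n ↦ (-1) ^ n * (pod n : K) := by
  classical
  ext n
  have hp (p : n.Partition) : p.parts.toFinsupp.prod (podWeight K) =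
      if ∀ i, Odd i → p.parts.count i ≤ 1 then (-1) ^ n else 0 := by
    rw [Finsupp.prod, Multiset.toFinsupp_support]
    unfold podWeight
    rw [prod_ite_zero, prod_pow_eq_pow_sum]
    simp only [Multiset.toFinsupp_apply]
    have hsum : ∑ i ∈ p.parts.toFinset, i * p.parts.count i = n := by
      simpa [mul_comm, p.parts_sum] using (sum_multiset_count p.parts).symm
    rw [hsum]
    refine if_congr ⟨fun h i hi ↦ ?_, fun h i _ ↦ h i⟩ rfl rfl
    by_cases hmem : i ∈ p.parts
    · exact h i (Multiset.mem_toFinset.2 hmem) hi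
    · simp [Multiset.count_eq_zero_of_notMem hmem]
  simp only [Nat.Partition.coeff_genFun, hp, coeff_mk]
  rw [← sum_filter, sum_const, nsmul_eq_mul, mul_comm, pod, Nat.card_eq_fintype_card,
    Fintype.card_subtype]

variable [TopologicalSpace K]

theorem tendsto_gaussProd : Tendsto (gaussProd K) atTop (𝓝 (psi K)) := by
  rw [WithPiTopology.tendsto_iff_coeff_tendsto]
  refine fun n ↦ tendsto_atTop_of_eventually_const (i₀ := n + 1) fun m hm ↦ ?_
  exact coeff_gaussProd (by omega)

theorem podWeight_factor_odd (k : ℕ) :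
    (1 + ∑' j, podWeight K (2 * k + 1) (j + 1) • (X : K⟦X⟧) ^ ((2 * k + 1) * (j + 1))) =
      1 - X ^ (2 * k + 1) := by
  rw [tsum_eq_single 0 fun j hj ↦ by simp [podWeight, hj]]
  simp [podWeight, pow_succ, pow_mul, sub_eq_add_neg]

variable [IsTopologicalRing K] [T2Space K]

theorem podWeight_factor_even_mul (k : ℕ) :
    (1 + ∑' j, podWeight K (2 * k + 1 + 1) (j + 1) • (X : K⟦X⟧) ^ ((2 * k + 1 + 1) * (j + 1))) *
      (1 - X ^ (2 * k + 2)) = 1 := by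
  have h0 : constantCoeff ((X : K⟦X⟧) ^ (2 * k + 2)) = 0 := by simp
  have hterm (j : ℕ) : podWeight K (2 * k + 1 + 1) (j + 1) •
      (X : K⟦X⟧) ^ ((2 * k + 1 + 1) * (j + 1)) = (X ^ (2 * k + 2)) ^ (j + 1) := by
    have h₁ : Even ((2 * k + 2) * (j + 1)) := ⟨(k + 1) * (j + 1), by ring⟩
    have h₂ : ¬Odd (2 * k + 2) := by simp [parity_simps]
    simp [podWeight, h₁.neg_one_pow, h₂, pow_mul]
  have hsum := WithPiTopology.summable_pow_of_constantCoeff_eq_zero h0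
  have h := WithPiTopology.tsum_pow_mul_one_sub_of_constantCoeff_eq_zero h0
  rw [hsum.tsum_eq_zero_add, pow_zero] at h
  simpa only [hterm] using h

theorem genFun_podWeight_mul_psi : Nat.Partition.genFun (podWeight K) * psi K = 1 := by
  have hprod (n : ℕ) : (∏ i ∈ range (2 * n), (1 + ∑' j, podWeight K (i + 1) (j + 1) •
      (X : K⟦X⟧) ^ ((i + 1) * (j + 1)))) * gaussProd K n = 1 := by
    induction n with
    | zero => simp [gaussProd]
    | succ n ih =>
      rw [show 2 * (n + 1) = 2 * n + 1 + 1 by ring, prod_range_succ, prod_range_succ,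
        podWeight_factor_odd, gaussProd, prod_range_succ, ← gaussProd]
      have he := podWeight_factor_even_mul (K := K) n
      have ho := one_sub_X_pow_succ_mul_inv (K := K) (2 * n)
      generalize (1 - (X : K⟦X⟧) ^ (2 * n + 1))⁻¹ = u at *
      generalize (1 + ∑' j, podWeight K (2 * n + 1 + 1) (j + 1) •
        (X : K⟦X⟧) ^ ((2 * n + 1 + 1) * (j + 1))) = t at *
      linear_combination ih + (∏ i ∈ range (2 * n), (1 + ∑' j, podWeight K (i + 1) (j + 1) •
        (X : K⟦X⟧) ^ ((i + 1) * (j + 1)))) * gaussProd K n *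
          ((1 - X ^ (2 * n + 1)) * u * he + ho)
  have hlim := ((Nat.Partition.hasProd_genFun (podWeight K)).tendsto_prod_nat.comp
    (tendsto_id.const_mul_atTop' (r := 2) two_pos)).mul (tendsto_gaussProd (K := K))
  refine tendsto_nhds_unique hlim (tendsto_const_nhds.congr fun n ↦ (hprod n).symm)

end ProductFormula

section Dissection

variable {R : Type*} [CommRing R]

theorem coeff_psi_three_mul_add_two (n : ℕ) : coeff (3 * n + 2) (psi R) = 0 := by
  have : IsEmpty {s // triangular s = 3 * n + 2} := by
    refine ⟨fun ⟨s, hs⟩ ↦ ?_⟩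
    have h := two_mul_triangular s
    rw [hs] at h
    have h3 := congrArg (· % 3) h
    have : s % 3 = 0 ∨ s % 3 = 1 ∨ s % 3 = 2 := by omega
    rcases this with h' | h' | h' <;> simp [Nat.mul_mod, Nat.add_mod, h'] at h3
  simp [coeff_fiberSeries]

theorem triangular_three_mul_add_one (t : ℕ) : triangular (3 * t + 1) = 9 * triangular t + 1 := by
  have h₁ := two_mul_triangular t
  have h₂ := two_mul_triangular (3 * t + 1)
  nlinarith

theorem exists_of_triangular_eq_three_mul_add_one {s n : ℕ} (h : triangular s = 3 * n + 1) :
    ∃ t, s = 3 * t + 1 ∧ n = 3 * triangular t := by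
  have hs : s % 3 = 1 := by
    have h2 := two_mul_triangular s
    rw [h] at h2
    have h3 := congrArg (· % 3) h2
    have : s % 3 = 0 ∨ s % 3 = 1 ∨ s % 3 = 2 := by omega
    rcases this with h' | h' | h'
    · simp [Nat.mul_mod, Nat.add_mod, h'] at h3
    · exact h'
    · simp [Nat.mul_mod, Nat.add_mod, h'] at h3
  obtain ⟨t, rfl⟩ : ∃ t, s = 3 * t + 1 := ⟨s / 3, by omega⟩
  rw [triangular_three_mul_add_one] at h
  exact ⟨t, rfl, by omega⟩

theorem coeff_psi_three_mul_add_one (n : ℕ) :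
    coeff (3 * n + 1) (psi R) = coeff n (expand 3 three_ne_zero (psi R)) := by
  rw [coeff_expand]
  split_ifs with h
  · obtain ⟨m, rfl⟩ := h
    rw [Nat.mul_div_cancel_left _ three_pos, coeff_fiberSeries, coeff_fiberSeries]
    congr 1
    symm
    refine Nat.card_congr (Equiv.ofBijective
      (fun t ↦ ⟨3 * t.1 + 1, by rw [triangular_three_mul_add_one, t.2]; ring⟩) ⟨?_, ?_⟩)
    · intro t t' h
      have := congrArg Subtype.val h
      exact Subtype.ext (by simpa using this)
    · rintro ⟨s, hs⟩
      obtain ⟨t, rfl, ht⟩ := exists_of_triangular_eq_three_mul_add_one hs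
      exact ⟨⟨t, by omega⟩, rfl⟩
  · have : IsEmpty {s // triangular s = 3 * n + 1} := by
      refine ⟨fun ⟨s, hs⟩ ↦ h ?_⟩
      obtain ⟨t, -, ht⟩ := exists_of_triangular_eq_three_mul_add_one hs
      exact ⟨_, ht⟩
    simp [coeff_fiberSeries]

/-- The series formed by the coefficients of `f` in degrees `≡ r` modulo `3`. -/
noncomputable def trisection (r : ℕ) (f : R⟦X⟧) : R⟦X⟧ :=
  PowerSeries.mk fun n ↦ coeff (3 * n + r) f

/-- The series with prescribed trisections. -/
noncomputable def ofTrisections (f g h : R⟦X⟧) : R⟦X⟧ :=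
  expand 3 three_ne_zero f + X * expand 3 three_ne_zero g + X ^ 2 * expand 3 three_ne_zero h

theorem coeff_ofTrisections_three_mul (f g h : R⟦X⟧) (n : ℕ) :
    coeff (3 * n) (ofTrisections f g h) = coeff n f := by
  rcases n with _ | n
  · simp [ofTrisections, pow_succ, mul_assoc]
  · rw [ofTrisections, map_add, map_add, coeff_expand_mul, show 3 * (n + 1) = 3 * n + 1 + 2 by ring,
      coeff_X_pow_mul, coeff_succ_X_mul, coeff_expand_of_not_dvd _ _ _ (by omega),
      coeff_expand_of_not_dvd _ _ _ (by omega), add_zero, add_zero]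

theorem coeff_ofTrisections_three_mul_add_one (f g h : R⟦X⟧) (n : ℕ) :
    coeff (3 * n + 1) (ofTrisections f g h) = coeff n g := by
  have hX : coeff (3 * n + 1) (X ^ 2 * expand 3 three_ne_zero h) = 0 := by
    rcases n with _ | n
    · simp [coeff_X_pow_mul']
    · rw [show 3 * (n + 1) + 1 = 3 * n + 2 + 2 by ring, coeff_X_pow_mul,
        coeff_expand_of_not_dvd _ _ _ (by omega)]
  rw [ofTrisections, map_add, map_add, hX, coeff_succ_X_mul, coeff_expand_mul,
    coeff_expand_of_not_dvd _ _ _ (by omega), zero_add, add_zero]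

theorem coeff_ofTrisections_three_mul_add_two (f g h : R⟦X⟧) (n : ℕ) :
    coeff (3 * n + 2) (ofTrisections f g h) = coeff n h := by
  rw [ofTrisections, map_add, map_add, coeff_X_pow_mul, coeff_expand_mul,
    coeff_expand_of_not_dvd _ _ _ (by omega), show 3 * n + 2 = 3 * n + 1 + 1 by ring,
    coeff_succ_X_mul, coeff_expand_of_not_dvd _ _ _ (by omega), zero_add, zero_add]

theorem ofTrisections_trisection (f : R⟦X⟧) :
    ofTrisections (trisection 0 f) (trisection 1 f) (trisection 2 f) = f := by
  ext n
  obtain ⟨m, rfl | rfl | rfl⟩ : ∃ m, n = 3 * m ∨ n = 3 * m + 1 ∨ n = 3 * m + 2 :=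
    ⟨n / 3, by omega⟩
  · simp [coeff_ofTrisections_three_mul, trisection]
  · simp [coeff_ofTrisections_three_mul_add_one, trisection]
  · simp [coeff_ofTrisections_three_mul_add_two, trisection]

theorem trisection_two_ofTrisections (f g h : R⟦X⟧) :
    trisection 2 (ofTrisections f g h) = h := by
  ext n
  rw [trisection, coeff_mk, coeff_ofTrisections_three_mul_add_two]

theorem trisection_two_expand_mul (f g : R⟦X⟧) :
    trisection 2 (expand 3 three_ne_zero f * g) = f * trisection 2 g := by
  have h : expand 3 three_ne_zero f * g =
      ofTrisections (f * trisection 0 g) (f * trisection 1 g) (f * trisection 2 g) := by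
    conv_lhs => rw [← ofTrisections_trisection g]
    simp only [ofTrisections, map_mul]
    ring
  rw [h, trisection_two_ofTrisections]

theorem trisection_two_psi_sq :
    trisection 2 (psi R ^ 2) = expand 3 three_ne_zero (psi R) ^ 2 := by
  have h₁ : trisection 1 (psi R) = expand 3 three_ne_zero (psi R) := by
    ext n
    rw [trisection, coeff_mk, coeff_psi_three_mul_add_one]
  have h₂ : trisection 2 (psi R) = 0 := by
    ext n
    rw [trisection, coeff_mk, coeff_psi_three_mul_add_two, map_zero]
  set ψ := psi R
  have h : ψ ^ 2 = ofTrisections (trisection 0 ψ ^ 2)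
      (2 * trisection 0 ψ * expand 3 three_ne_zero ψ) (expand 3 three_ne_zero ψ ^ 2) := by
    conv_lhs => rw [← ofTrisections_trisection ψ, h₁, h₂]
    simp only [ofTrisections, map_mul, map_pow, map_zero, map_ofNat]
    ring
  rw [h, trisection_two_ofTrisections]

theorem expand_three_eq_pow (f : (ZMod 3)⟦X⟧) : expand 3 three_ne_zero f = f ^ 3 := by
  have h := MvPowerSeries.map_frobenius_expand (R := ZMod 3) 3 three_ne_zero (f := f)
  rw [ZMod.frobenius_zmod] at h
  simpa [expand] using h

theorem neg_one_pow_mul_pod_eq_coeff (n : ℕ) :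
    (-1) ^ n * (pod (3 * n + 2) : ZMod 3) = coeff n (psi (ZMod 3) ^ 5) := by
  set ψ := psi (ZMod 3)
  set G := Nat.Partition.genFun (podWeight (ZMod 3)) with hG
  have h₁ : G * ψ = 1 := genFun_podWeight_mul_psi
  have h₂ : ψ * trisection 2 G = ψ ^ 6 := by
    rw [← trisection_two_expand_mul, expand_three_eq_pow,
      show ψ ^ 3 * G = ψ ^ 2 by linear_combination ψ ^ 2 * h₁, trisection_two_psi_sq,
      expand_three_eq_pow, ← pow_mul]
  have h₃ : trisection 2 G = ψ ^ 5 := by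
    linear_combination G * h₂ + (ψ ^ 5 - trisection 2 G) * h₁
  rw [← h₃, trisection, coeff_mk, hG, genFun_podWeight, coeff_mk]
  congr 1
  rw [pow_add, pow_mul]
  norm_num

end Dissection

/-- The integer quintuples whose squares sum to `N`. -/
noncomputable def fiveSquares (N : ℕ) : Finset (ℤ × ℤ × ℤ × ℤ × ℤ) :=
  {x ∈ Icc (-N, -N, -N, -N, -N) (N, N, N, N, N) |
    x.1 ^ 2 + x.2.1 ^ 2 + x.2.2.1 ^ 2 + x.2.2.2.1 ^ 2 + x.2.2.2.2 ^ 2 = (N : ℤ)}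

theorem mem_fiveSquares {N : ℕ} {x : ℤ × ℤ × ℤ × ℤ × ℤ} : x ∈ fiveSquares N ↔
    x.1 ^ 2 + x.2.1 ^ 2 + x.2.2.1 ^ 2 + x.2.2.2.1 ^ 2 + x.2.2.2.2 ^ 2 = (N : ℤ) := by
  rw [fiveSquares, mem_filter, and_iff_right_iff_imp]
  obtain ⟨a, b, c, d, e⟩ := x
  intro h
  simp only at h
  have bound (z : ℤ) (hz : z ^ 2 ≤ N) : -(N : ℤ) ≤ z ∧ z ≤ N :=
    ⟨by nlinarith [Int.le_self_sq (-z)], by nlinarith [Int.le_self_sq z]⟩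
  have ha := bound a (by nlinarith)
  have hb := bound b (by nlinarith)
  have hc := bound c (by nlinarith)
  have hd := bound d (by nlinarith)
  have he := bound e (by nlinarith)
  simp only [mem_Icc, Prod.mk_le_mk]
  tauto

theorem r5_eq_card (N : ℕ) : r5 N = #(fiveSquares N) :=
  Nat.subtype_card _ fun _ ↦ mem_fiveSquares

theorem card_filter_fiveSquares_comp {N : ℕ} {σ : ℤ × ℤ × ℤ × ℤ × ℤ → ℤ × ℤ × ℤ × ℤ × ℤ}
    (hσ : Function.Involutive σ) (hN : ∀ x ∈ fiveSquares N, σ x ∈ fiveSquares N)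
    (p : ℤ × ℤ × ℤ × ℤ × ℤ → Prop) [DecidablePred p] :
    #{x ∈ fiveSquares N | p (σ x)} = #{x ∈ fiveSquares N | p x} := by
  refine card_nbij' σ σ ?_ ?_ (fun x _ ↦ hσ x) (fun x _ ↦ hσ x)
  · intro x hx
    simp only [coe_filter, Set.mem_ofPred_eq] at hx ⊢
    exact ⟨hN x hx.1, hx.2⟩
  · intro x hx
    simp only [coe_filter, Set.mem_ofPred_eq] at hx ⊢
    exact ⟨hN x hx.1, by rw [hσ x]; exact hx.2⟩

/-- All five coordinates are odd. -/
abbrev AllOdd (x : ℤ × ℤ × ℤ × ℤ × ℤ) : Prop :=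
  Odd x.1 ∧ Odd x.2.1 ∧ Odd x.2.2.1 ∧ Odd x.2.2.2.1 ∧ Odd x.2.2.2.2

/-- The first coordinate is the only odd one. -/
abbrev OnlyFirstOdd (x : ℤ × ℤ × ℤ × ℤ × ℤ) : Prop :=
  Odd x.1 ∧ Even x.2.1 ∧ Even x.2.2.1 ∧ Even x.2.2.2.1 ∧ Even x.2.2.2.2

theorem parity_sq_mod_four (a : ℤ) :
    (Even a ∧ ¬Odd a ∧ a ^ 2 % 4 = 0) ∨ (Odd a ∧ ¬Even a ∧ a ^ 2 % 4 = 1) := by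
  rcases Int.even_or_odd a with h | h
  · refine .inl ⟨h, Int.not_odd_iff_even.2 h, ?_⟩
    obtain ⟨k, rfl⟩ := h
    ring_nf
    omega
  · exact .inr ⟨h, Int.not_even_iff_odd.2 h, Int.sq_mod_four_eq_one_of_odd h⟩

theorem card_fiveSquares {N : ℕ} (hN : N % 8 = 5) : #(fiveSquares N) =
    #{x ∈ fiveSquares N | AllOdd x} + 5 * #{x ∈ fiveSquares N | OnlyFirstOdd x} := by
  have h₂ := card_filter_fiveSquares_comp (N := N) (σ := fun x ↦ (x.2.1, x.1, x.2.2))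
    (fun _ ↦ rfl) (fun x hx ↦ by rw [mem_fiveSquares] at hx ⊢; linarith) OnlyFirstOdd
  have h₃ := card_filter_fiveSquares_comp (N := N)
    (σ := fun x ↦ (x.2.2.1, x.2.1, x.1, x.2.2.2))
    (fun _ ↦ rfl) (fun x hx ↦ by rw [mem_fiveSquares] at hx ⊢; linarith) OnlyFirstOdd
  have h₄ := card_filter_fiveSquares_comp (N := N)
    (σ := fun x ↦ (x.2.2.2.1, x.2.1, x.2.2.1, x.1, x.2.2.2.2))
    (fun _ ↦ rfl) (fun x hx ↦ by rw [mem_fiveSquares] at hx ⊢; linarith) OnlyFirstOdd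
  have h₅ := card_filter_fiveSquares_comp (N := N)
    (σ := fun x ↦ (x.2.2.2.2, x.2.1, x.2.2.1, x.2.2.2.1, x.1))
    (fun _ ↦ rfl) (fun x hx ↦ by rw [mem_fiveSquares] at hx ⊢; linarith) OnlyFirstOdd
  have hsplit : #(fiveSquares N) = #{x ∈ fiveSquares N | AllOdd x} +
      #{x ∈ fiveSquares N | OnlyFirstOdd x} +
      #{x ∈ fiveSquares N | OnlyFirstOdd (x.2.1, x.1, x.2.2)} +
      #{x ∈ fiveSquares N | OnlyFirstOdd (x.2.2.1, x.2.1, x.1, x.2.2.2)} +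
      #{x ∈ fiveSquares N | OnlyFirstOdd (x.2.2.2.1, x.2.1, x.2.2.1, x.1, x.2.2.2.2)} +
      #{x ∈ fiveSquares N | OnlyFirstOdd (x.2.2.2.2, x.2.1, x.2.2.1, x.2.2.2.1, x.1)} := by
    rw [card_eq_sum_ones]
    simp only [card_filter, ← sum_add_distrib]
    refine sum_congr rfl fun x hx ↦ ?_
    rw [mem_fiveSquares] at hx
    obtain ⟨a, b, c, d, e⟩ := x
    simp only [AllOdd, OnlyFirstOdd] at hx ⊢
    rcases parity_sq_mod_four a with ⟨a₁, a₂, a₃⟩ | ⟨a₁, a₂, a₃⟩ <;>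
    rcases parity_sq_mod_four b with ⟨b₁, b₂, b₃⟩ | ⟨b₁, b₂, b₃⟩ <;>
    rcases parity_sq_mod_four c with ⟨c₁, c₂, c₃⟩ | ⟨c₁, c₂, c₃⟩ <;>
    rcases parity_sq_mod_four d with ⟨d₁, d₂, d₃⟩ | ⟨d₁, d₂, d₃⟩ <;>
    rcases parity_sq_mod_four e with ⟨e₁, e₂, e₃⟩ | ⟨e₁, e₂, e₃⟩ <;>
    first
    | (exfalso; omega)
    | simp only [a₁, a₂, b₁, b₂, c₁, c₂, d₁, d₂, e₁, e₂, and_true, and_false, if_true, if_false]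
  omega

/-- An isometry of the last four coordinates, exchanging quadruples of even integers having an odd
half-sum with quadruples of odd integers having an even half-sum. -/
def halfSumReflection (x : ℤ × ℤ × ℤ × ℤ × ℤ) : ℤ × ℤ × ℤ × ℤ × ℤ :=
  let s := (x.2.1 + x.2.2.1 + x.2.2.2.1 + x.2.2.2.2) / 2
  (x.1, s, s - x.2.2.2.1 - x.2.2.2.2, s - x.2.2.1 - x.2.2.2.2, s - x.2.2.1 - x.2.2.2.1)

theorem halfSumReflection_halfSumReflection {x : ℤ × ℤ × ℤ × ℤ × ℤ}
    (hx : Even (x.2.1 + x.2.2.1 + x.2.2.2.1 + x.2.2.2.2)) :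
    halfSumReflection (halfSumReflection x) = x := by
  obtain ⟨a, b, c, d, e⟩ := x
  obtain ⟨s, hs⟩ := hx
  simp only [halfSumReflection, Prod.mk.injEq, true_and] at hs ⊢
  refine ⟨?_, ?_, ?_, ?_⟩ <;> omega

theorem halfSumReflection_mem_fiveSquares {N : ℕ} {x : ℤ × ℤ × ℤ × ℤ × ℤ}
    (hx : Even (x.2.1 + x.2.2.1 + x.2.2.2.1 + x.2.2.2.2)) (hN : x ∈ fiveSquares N) :
    halfSumReflection x ∈ fiveSquares N := by
  obtain ⟨a, b, c, d, e⟩ := x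
  obtain ⟨s, hs⟩ := hx
  rw [mem_fiveSquares] at hN ⊢
  simp only [halfSumReflection] at hs hN ⊢
  rw [show (b + c + d + e) / 2 = s by omega]
  obtain rfl : b = s + s - c - d - e := by omega
  linear_combination hN

theorem card_onlyFirstOdd {N : ℕ} (hN : N % 8 = 5) :
    #{x ∈ fiveSquares N | OnlyFirstOdd x} =
      #{x ∈ fiveSquares N | AllOdd x ∧ 4 ∣ x.2.1 + x.2.2.1 + x.2.2.2.1 + x.2.2.2.2} := by
  have hE (x) (hx : OnlyFirstOdd x) : Even (x.2.1 + x.2.2.1 + x.2.2.2.1 + x.2.2.2.2) :=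
    ((hx.2.1.add hx.2.2.1).add hx.2.2.2.1).add hx.2.2.2.2
  have hO (x) (hx : AllOdd x) : Even (x.2.1 + x.2.2.1 + x.2.2.2.1 + x.2.2.2.2) :=
    ((hx.2.1.add_odd hx.2.2.1).add_odd hx.2.2.2.1).add_odd hx.2.2.2.2
  refine card_nbij' halfSumReflection halfSumReflection ?_ ?_ ?_ ?_
  · intro x hx
    simp only [coe_filter, Set.mem_ofPred_eq] at hx ⊢
    refine ⟨halfSumReflection_mem_fiveSquares (hE x hx.2) hx.1, ?_⟩
    obtain ⟨a, b, c, d, e⟩ := x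
    obtain ⟨hx, ha, ⟨b, rfl⟩, ⟨c, rfl⟩, ⟨d, rfl⟩, ⟨e, rfl⟩⟩ := hx
    rw [mem_fiveSquares] at hx
    have ha' := Int.eight_dvd_sq_sub_one_of_odd ha
    simp only [AllOdd, halfSumReflection] at hx ha ha' ⊢
    have hodd : Odd (b ^ 2 + c ^ 2 + d ^ 2 + e ^ 2) := by
      rw [Int.odd_iff]
      ring_nf at hx
      omega
    have hs : Odd (b + c + d + e) := by
      simpa [parity_simps] using hodd
    rw [Int.odd_iff] at hs
    refine ⟨⟨ha, ?_⟩, ?_⟩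
    · simp only [Int.odd_iff]
      omega
    · omega
  · intro x hx
    simp only [coe_filter, Set.mem_ofPred_eq] at hx ⊢
    refine ⟨halfSumReflection_mem_fiveSquares (hO x hx.2.1) hx.1, ?_⟩
    obtain ⟨a, b, c, d, e⟩ := x
    obtain ⟨-, ⟨ha, hbcde⟩, hdvd⟩ := hx
    simp only [OnlyFirstOdd, halfSumReflection, Int.odd_iff] at *
    refine ⟨ha, ?_⟩
    simp only [Int.even_iff]
    omega
  · intro x hx
    simp only [coe_filter, Set.mem_ofPred_eq] at hx
    exact halfSumReflection_halfSumReflection (hE x hx.2)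
  · intro x hx
    simp only [coe_filter, Set.mem_ofPred_eq] at hx
    exact halfSumReflection_halfSumReflection (hO x hx.2.1)

theorem card_allOdd {N : ℕ} (hN : N % 8 = 5) :
    #{x ∈ fiveSquares N | AllOdd x} = 2 * #{x ∈ fiveSquares N | OnlyFirstOdd x} := by
  have hneg := card_filter_fiveSquares_comp (N := N) (σ := fun x ↦ (x.1, -x.2.1, x.2.2))
    (fun x ↦ by simp) (fun x hx ↦ by rw [mem_fiveSquares] at hx ⊢; linear_combination hx)
    (fun x ↦ AllOdd x ∧ 4 ∣ x.2.1 + x.2.2.1 + x.2.2.2.1 + x.2.2.2.2)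
  have hcongr : #{x ∈ fiveSquares N | AllOdd x ∧ ¬4 ∣ x.2.1 + x.2.2.1 + x.2.2.2.1 + x.2.2.2.2} =
      #{x ∈ fiveSquares N | AllOdd (x.1, -x.2.1, x.2.2) ∧
        4 ∣ -x.2.1 + x.2.2.1 + x.2.2.2.1 + x.2.2.2.2} := by
    refine congrArg card (filter_congr fun x _ ↦ ?_)
    simp only [AllOdd, Int.odd_iff]
    omega
  rw [← card_filter_add_card_filter_not
    (fun x : ℤ × ℤ × ℤ × ℤ × ℤ ↦ 4 ∣ x.2.1 + x.2.2.1 + x.2.2.2.1 + x.2.2.2.2),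
    filter_filter, filter_filter, hcongr, hneg, card_onlyFirstOdd hN]
  ring

theorem r5_cast_eq {N : ℕ} (hN : N % 8 = 5) :
    (r5 N : ZMod 3) = -(#{x ∈ fiveSquares N | AllOdd x} : ZMod 3) := by
  rw [r5_eq_card, card_fiveSquares hN, card_allOdd hN]
  push_cast
  linear_combination 3 * #{x ∈ fiveSquares N | OnlyFirstOdd x} * CharP.cast_eq_zero (ZMod 3) 3

/-- The triangular number `k (k + 1) / 2` of an integer `k`. -/
def intTriangular : ℤ → ℕ
  | .ofNat n => triangular n
  | .negSucc n => triangular n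

theorem eight_mul_intTriangular_add_one (k : ℤ) :
    8 * (intTriangular k : ℤ) + 1 = (2 * k + 1) ^ 2 := by
  rcases k with n | n
  · have h : (2 : ℤ) * triangular n = n * (n + 1) := mod_cast two_mul_triangular n
    simp only [intTriangular, Int.ofNat_eq_natCast]
    linear_combination 4 * h
  · have h : (2 : ℤ) * triangular n = n * (n + 1) := mod_cast two_mul_triangular n
    simp only [intTriangular, Int.negSucc_eq]
    linear_combination 4 * h

/-- Each fibre of `intTriangular` is two copies of the corresponding fibre of `triangular`. -/
def intTriangularFiberEquiv (n : ℕ) :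
    {k // intTriangular k = n} ≃ {s // triangular s = n} ⊕ {s // triangular s = n} :=
  (Equiv.intEquivNatSumNat.subtypeEquiv
    (q := Sum.elim (triangular · = n) (triangular · = n))
    (by rintro (_ | _) <;> rfl)).trans Equiv.subtypeSum

theorem finite_intTriangular_fiber (n : ℕ) : Finite {k // intTriangular k = n} := by
  have := finite_triangular_fiber n
  exact Finite.of_equiv _ (intTriangularFiberEquiv n).symm

theorem fiberSeries_intTriangular (R : Type*) [CommSemiring R] :
    fiberSeries R intTriangular = 2 * psi R := by
  ext n
  have := finite_triangular_fiber n
  rw [two_mul, map_add, coeff_fiberSeries, coeff_fiberSeries,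
    Nat.card_congr (intTriangularFiberEquiv n), Nat.card_sum, Nat.cast_add]

theorem card_allOdd_eq (n : ℕ) : #{x ∈ fiveSquares (8 * n + 5) | AllOdd x} =
    Nat.card {k : ℤ × ℤ × ℤ × ℤ × ℤ // intTriangular k.1 + (intTriangular k.2.1 +
      (intTriangular k.2.2.1 + (intTriangular k.2.2.2.1 + intTriangular k.2.2.2.2))) = n} := by
  have hiff (k : ℤ × ℤ × ℤ × ℤ × ℤ) :
      (2 * k.1 + 1, 2 * k.2.1 + 1, 2 * k.2.2.1 + 1, 2 * k.2.2.2.1 + 1, 2 * k.2.2.2.2 + 1) ∈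
        fiveSquares (8 * n + 5) ↔ intTriangular k.1 + (intTriangular k.2.1 +
      (intTriangular k.2.2.1 + (intTriangular k.2.2.2.1 + intTriangular k.2.2.2.2))) = n := by
    simp only [mem_fiveSquares, ← eight_mul_intTriangular_add_one]
    push_cast
    omega
  rw [← Nat.card_eq_finsetCard]
  symm
  refine Nat.card_congr (Equiv.ofBijective (fun k ↦ ⟨(2 * k.1.1 + 1, 2 * k.1.2.1 + 1,
    2 * k.1.2.2.1 + 1, 2 * k.1.2.2.2.1 + 1, 2 * k.1.2.2.2.2 + 1),
    mem_filter.2 ⟨(hiff k.1).2 k.2, by simp [AllOdd]⟩⟩) ⟨?_, ?_⟩)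
  · rintro ⟨⟨a, b, c, d, e⟩, _⟩ ⟨⟨a₂, b₂, c₂, d₂, e₂⟩, _⟩ h
    simpa using h
  · rintro ⟨⟨a, b, c, d, e⟩, h⟩
    obtain ⟨h, ⟨a, rfl⟩, ⟨b, rfl⟩, ⟨c, rfl⟩, ⟨d, rfl⟩, ⟨e, rfl⟩⟩ := mem_filter.1 h
    exact ⟨⟨(a, b, c, d, e), (hiff (a, b, c, d, e)).1 h⟩, rfl⟩

theorem coeff_psi_pow_five (n : ℕ) :
    coeff n (psi (ZMod 3) ^ 5) = (r5 (8 * n + 5) : ZMod 3) := by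
  have hf := finite_intTriangular_fiber
  have hf₂ := finite_fiber_add hf hf
  have hf₃ := finite_fiber_add hf hf₂
  have hf₄ := finite_fiber_add hf hf₃
  rw [r5_cast_eq (by omega), card_allOdd_eq, ← coeff_fiberSeries, ← fiberSeries_mul hf hf₄,
    ← fiberSeries_mul hf hf₃, ← fiberSeries_mul hf hf₂, ← fiberSeries_mul hf hf,
    fiberSeries_intTriangular, ← map_neg]
  congr 1
  have h3 : (3 : (ZMod 3)⟦X⟧) = 0 := by
    rw [← map_ofNat (C (R := ZMod 3)) 3, show (OfNat.ofNat 3 : ZMod 3) = 0 from rfl, map_zero]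
  linear_combination 11 * psi (ZMod 3) ^ 5 * h3

theorem pod_congr (n : ℕ) :
    (pod (3 * n + 2) : ℤ) ≡ (-1) ^ n * r5 (8 * n + 5) [ZMOD 3] := by
  apply (ZMod.intCast_eq_intCast_iff _ _ 3).1
  push_cast
  rw [← coeff_psi_pow_five, ← neg_one_pow_mul_pod_eq_coeff, ← mul_assoc, ← mul_pow]
  simp
end
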